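/- Consider the downlink MU-MIMO model with users indexed by the finite set I, channel matrices H_{b'→(k,b)} ∈ ℂ^{N×M}, noise power σ² > 0, rates r_{k,b}(V), and sum-least-m and sum-greatest-m utilities f_m, F_m with 1 ≤ m ≤ |I|. For receive vectors U = (u_{k,b})_{(k,b)∈I}, u_{k,b} ∈ ℂ^N, define the mean squared error e_{k,b}(U,V) = |1 − u_{k,b}† H_{b→(k,b)} v_{k,b}|² + ∑_{(k',b')≠(k,b)} |u_{k,b}† H_{b'→(k,b)} v_{k',b'}|² + σ² ‖u_{k,b}‖², and for positive weights W = (w_{k,b})_{(k,b)∈I}, the weighted MSE ř_{k,b}(W,U,V) = w_{k,b}·e_{k,b}(U,V) − log w_{k,b} − 1. Then for every V: the infimum over all U and all W with w_{k,b} > 0 of F_m((ř_{k,b}(W,U,V))_{(k,b)∈I}) equals −f_m((r_{k,b}(V))_{(k,b)∈I}), and it is attained at u_{k,b} = (σ² I + ∑_{(k',b')} H_{b'→(k,b)} v_{k',b'} v_{k',b'}† H_{b'→(k,b)}†)⁻¹ H_{b→(k,b)} v_{k,b} and w_{k,b} = (1 − v_{k,b}† H_{b→(k,b)}† (σ² I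 + ∑_{(k',b')} H_{b'→(k,b)} v_{k',b'} v_{k',b'}† H_{b'→(k,b)}†)⁻¹ H_{b→(k,b)} v_{k,b})⁻¹, where the sums over (k',b') run over all users including (k,b). -/

import Mathlib

open Matrix

/-- The sum-least-`m` (SLqP) utility: the minimum over all subsets `S` of the index set
with `|S| = m` of `∑_{i∈S} x i`, i.e. the sum of the `m` smallest entries of `x`. -/
noncomputable def sumLeast {I : Type*} [Fintype I] (m : ℕ) (x : I → ℝ) : ℝ :=
  sInf {s : ℝ | ∃ S : Finset I, S.card = m ∧ s = ∑ i ∈ S, x i}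

/-- The sum-greatest-`m` (SGqP) utility: the maximum over all subsets `S` of the index set
with `|S| = m` of `∑_{i∈S} x i`, i.e. the sum of the `m` largest entries of `x`. -/
noncomputable def sumGreatest {I : Type*} [Fintype I] (m : ℕ) (x : I → ℝ) : ℝ :=
  sSup {s : ℝ | ∃ S : Finset I, S.card = m ∧ s = ∑ i ∈ S, x i}

section Model

variable {I B' : Type*} [Fintype I] [DecidableEq I] {N M : ℕ}

/-- Interference-plus-noise covariance of user `i`:
`B_i(V) = σ² I + ∑_{j ≠ i} (H_{cell j → i} v_j)(H_{cell j → i} v_j)†`. -/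
noncomputable def covIN (cell : I → B') (H : B' → I → Matrix (Fin N) (Fin M) ℂ)
    (σ2 : ℝ) (V : I → Fin M → ℂ) (i : I) : Matrix (Fin N) (Fin N) ℂ :=
  (σ2 : ℂ) • (1 : Matrix (Fin N) (Fin N) ℂ) +
    ∑ j ∈ Finset.univ.erase i,
      vecMulVec (H (cell j) i *ᵥ V j) (star (H (cell j) i *ᵥ V j))

/-- Achieved rate of user `i`:
`r_i(V) = log(1 + v_i† H_i† B_i(V)⁻¹ H_i v_i)`. -/
noncomputable def rate (cell : I → B') (H : B' → I → Matrix (Fin N) (Fin M) ℂ)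
    (σ2 : ℝ) (V : I → Fin M → ℂ) (i : I) : ℝ :=
  Real.log (1 + (star (H (cell i) i *ᵥ V i) ⬝ᵥ
    (covIN cell H σ2 V i)⁻¹ *ᵥ (H (cell i) i *ᵥ V i)).re)

/-- The argument of the logarithm in the QFT-transformed rate:
`φ_i(X,V) = 1 + 2 Re(χ_i† H_i v_i) − χ_i† B_i(V) χ_i`. -/
noncomputable def qftArg (cell : I → B') (H : B' → I → Matrix (Fin N) (Fin M) ℂ)
    (σ2 : ℝ) (X : I → Fin N → ℂ) (V : I → Fin M → ℂ) (i : I) : ℝ :=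
  1 + 2 * (star (X i) ⬝ᵥ (H (cell i) i *ᵥ V i)).re -
    (star (X i) ⬝ᵥ (covIN cell H σ2 V i) *ᵥ X i).re

end Model

section MSE

variable {I B' : Type*} [Fintype I] [DecidableEq I] {N M : ℕ}

/-- The full (signal-plus-interference-plus-noise) covariance of user `i`:
`σ² I + ∑_{(k',b')} (H_{b'→(k,b)} v_{k',b'})(H_{b'→(k,b)} v_{k',b'})†`, the sum running
over all users including `i`. -/
noncomputable def covFull (cell : I → B') (H : B' → I → Matrix (Fin N) (Fin M) ℂ)
    (σ2 : ℝ) (V : I → Fin M → ℂ) (i : I) : Matrix (Fin N) (Fin N) ℂ :=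
  (σ2 : ℂ) • (1 : Matrix (Fin N) (Fin N) ℂ) +
    ∑ j : I, vecMulVec (H (cell j) i *ᵥ V j) (star (H (cell j) i *ᵥ V j))

/-- The mean squared error of user `i` for receive vectors `U` and transmit beamformers
`V`: `e_i(U,V) = |1 − u_i† H_i v_i|² + ∑_{j≠i} |u_i† H_{cell j → i} v_j|² + σ² ‖u_i‖²`. -/
noncomputable def mse (cell : I → B') (H : B' → I → Matrix (Fin N) (Fin M) ℂ)
    (σ2 : ℝ) (U : I → Fin N → ℂ) (V : I → Fin M → ℂ) (i : I) : ℝ :=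
  Complex.normSq (1 - star (U i) ⬝ᵥ (H (cell i) i *ᵥ V i)) +
    ∑ j ∈ Finset.univ.erase i, Complex.normSq (star (U i) ⬝ᵥ (H (cell j) i *ᵥ V j)) +
    σ2 * ∑ t, Complex.normSq (U i t)

end MSE

theorem aux_sumGreatest_neg {I : Type*} [Fintype I] (m : ℕ) (x : I → ℝ) :
    sumGreatest m (fun i => - x i) = - sumLeast m x := by
  unfold sumGreatest sumLeast
  rw [Real.sInf_def, neg_neg]
  congr 1
  ext s
  simp only [Set.mem_ofPred_eq, Set.mem_neg, Finset.sum_neg_distrib]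
  constructor
  · rintro ⟨S, h1, h2⟩
    exact ⟨S, h1, by rw [h2, neg_neg]⟩
  · rintro ⟨S, h1, h2⟩
    exact ⟨S, h1, by rw [← h2, neg_neg]⟩

theorem aux_sumGreatest_mono {I : Type*} [Fintype I] (m : ℕ) (hm : m ≤ Fintype.card I)
    (x y : I → ℝ) (h : ∀ i, x i ≤ y i) : sumGreatest m x ≤ sumGreatest m y := by
  unfold sumGreatest
  apply csSup_le
  · obtain ⟨S, -, hS⟩ := Finset.exists_subset_card_eq (s := (Finset.univ : Finset I)) (n := m)
      (by simpa using hm)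
    exact ⟨_, S, hS, rfl⟩
  · rintro s ⟨S, hS, rfl⟩
    refine (Finset.sum_le_sum (fun i _ => h i)).trans (le_csSup ?_ ⟨S, hS, rfl⟩)
    apply Set.Finite.bddAbove
    refine (Set.finite_range (fun S : Finset I => ∑ i ∈ S, y i)).subset ?_
    rintro s ⟨S, -, rfl⟩
    exact ⟨S, rfl⟩

theorem aux_quad_vec {N : ℕ} (u a : Fin N → ℂ) :
    star u ⬝ᵥ (vecMulVec a (star a)) *ᵥ u = (Complex.normSq (star u ⬝ᵥ a) : ℂ) := by
  rw [vecMulVec_mulVec, ← Complex.mul_conj]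
  have : (starRingEnd ℂ) (star u ⬝ᵥ a) = star a ⬝ᵥ u := by
    rw [starRingEnd_apply, star_dotProduct, star_star]
  rw [this]
  simp [dotProduct_smul, mul_comm]

section
open scoped ComplexOrder
variable {I B' : Type*} [Fintype I] [DecidableEq I] {N M : ℕ}
    (cell : I → B') (H : B' → I → Matrix (Fin N) (Fin M) ℂ)
    (σ2 : ℝ) (V : I → Fin M → ℂ) (i : I)

theorem aux_full_eq : covFull cell H σ2 V i = covIN cell H σ2 V i +
    vecMulVec (H (cell i) i *ᵥ V i) (star (H (cell i) i *ᵥ V i)) := by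
  unfold covFull covIN
  rw [add_assoc, Finset.sum_erase_add _ _ (Finset.mem_univ i)]

theorem aux_posDef_IN (hσ : 0 < σ2) : (covIN cell H σ2 V i).PosDef := by
  unfold covIN
  apply Matrix.PosDef.add_posSemidef
  · exact Matrix.PosDef.smul Matrix.PosDef.one (by exact_mod_cast hσ)
  · exact Matrix.posSemidef_sum _ (fun j _ => Matrix.posSemidef_vecMulVec_self_star _)

theorem aux_posDef_full (hσ : 0 < σ2) : (covFull cell H σ2 V i).PosDef := by
  rw [aux_full_eq]
  exact (aux_posDef_IN cell H σ2 V i hσ).add_posSemidef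
    (Matrix.posSemidef_vecMulVec_self_star _)

theorem aux_mse (U : I → Fin N → ℂ) : mse cell H σ2 U V i =
    1 - 2 * (star (U i) ⬝ᵥ (H (cell i) i *ᵥ V i)).re +
      (star (U i) ⬝ᵥ covFull cell H σ2 V i *ᵥ U i).re := by
  have h1 : (star (U i) ⬝ᵥ covFull cell H σ2 V i *ᵥ U i) =
      ((σ2 * ∑ t, Complex.normSq (U i t) +
        ∑ j, Complex.normSq (star (U i) ⬝ᵥ (H (cell j) i *ᵥ V j)) : ℝ) : ℂ) := by
    unfold covFull
    rw [add_mulVec, sum_mulVec, dotProduct_add, dotProduct_sum]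
    push_cast
    congr 1
    · rw [smul_mulVec, one_mulVec, dotProduct_smul, smul_eq_mul]
      congr 1
      simp only [dotProduct]
      refine Finset.sum_congr rfl fun t _ => ?_
      rw [Complex.normSq_eq_conj_mul_self]; rfl
    · exact Finset.sum_congr rfl fun j _ => aux_quad_vec _ _
  rw [h1, Complex.ofReal_re, ← Finset.sum_erase_add _ _ (Finset.mem_univ i)]
  unfold mse
  have : ∀ z : ℂ, Complex.normSq (1 - z) = 1 - 2 * z.re + Complex.normSq z := by
    intro z
    simp [Complex.normSq_apply]; ring
  rw [this]
  ring

theorem aux_opt (hσ : 0 < σ2) (U : I → Fin N → ℂ) :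
    mse cell H σ2 U V i = 1 - (star (H (cell i) i *ᵥ V i) ⬝ᵥ
          (covFull cell H σ2 V i)⁻¹ *ᵥ (H (cell i) i *ᵥ V i)).re +
      (star (U i - (covFull cell H σ2 V i)⁻¹ *ᵥ (H (cell i) i *ᵥ V i)) ⬝ᵥ
        covFull cell H σ2 V i *ᵥ
          (U i - (covFull cell H σ2 V i)⁻¹ *ᵥ (H (cell i) i *ᵥ V i))).re := by
  rw [aux_mse]
  have hC := aux_posDef_full cell H σ2 V i hσ
  generalize covFull cell H σ2 V i = C at *
  generalize H (cell i) i *ᵥ V i = h at *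
  generalize U i = u
  have hdet : IsUnit C.det := (Matrix.isUnit_iff_isUnit_det C).1 hC.isUnit
  have hx : C *ᵥ (C⁻¹ *ᵥ h) = h := by
    rw [mulVec_mulVec, Matrix.mul_nonsing_inv _ hdet, one_mulVec]
  generalize C⁻¹ *ᵥ h = x at *
  have hre : ∀ a b : Fin N → ℂ, (star a ⬝ᵥ b).re = (star b ⬝ᵥ a).re := by
    intro a b
    simp only [dotProduct, Complex.re_sum]
    refine Finset.sum_congr rfl fun t _ => ?_
    simp; ring
  have h2 : star x ⬝ᵥ C *ᵥ u = star h ⬝ᵥ u := by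
    rw [dotProduct_mulVec, ← hx, star_mulVec, hC.isHermitian.eq]
  rw [mulVec_sub, star_sub, sub_dotProduct, dotProduct_sub, dotProduct_sub, hx, h2]
  simp only [Complex.sub_re]
  rw [hre h u, hre x h]
  ring

theorem aux_inv (hσ : 0 < σ2) :
    0 < 1 + (star (H (cell i) i *ᵥ V i) ⬝ᵥ
      (covIN cell H σ2 V i)⁻¹ *ᵥ (H (cell i) i *ᵥ V i)).re ∧
    1 - (star (H (cell i) i *ᵥ V i) ⬝ᵥ
      (covFull cell H σ2 V i)⁻¹ *ᵥ (H (cell i) i *ᵥ V i)).re =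
    (1 + (star (H (cell i) i *ᵥ V i) ⬝ᵥ
      (covIN cell H σ2 V i)⁻¹ *ᵥ (H (cell i) i *ᵥ V i)).re)⁻¹ := by
  have hC := aux_posDef_full cell H σ2 V i hσ
  have hB := aux_posDef_IN cell H σ2 V i hσ
  have hCB := aux_full_eq cell H σ2 V i
  generalize covFull cell H σ2 V i = C at *
  generalize covIN cell H σ2 V i = B at *
  generalize H (cell i) i *ᵥ V i = h at *
  have hdC : IsUnit C.det := (Matrix.isUnit_iff_isUnit_det C).1 hC.isUnit
  have hdB : IsUnit B.det := (Matrix.isUnit_iff_isUnit_det B).1 hB.isUnit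
  have hb : 0 ≤ star h ⬝ᵥ B⁻¹ *ᵥ h := hB.inv.posSemidef.dotProduct_mulVec_nonneg h
  have hx : B *ᵥ (B⁻¹ *ᵥ h) = h := by
    rw [mulVec_mulVec, Matrix.mul_nonsing_inv _ hdB, one_mulVec]
  generalize B⁻¹ *ᵥ h = x at *
  obtain ⟨b, hb0, hbe⟩ : ∃ b : ℝ, 0 ≤ b ∧ star h ⬝ᵥ x = (b : ℂ) := by
    rw [Complex.le_def] at hb
    exact ⟨_, hb.1, Complex.ext rfl hb.2.symm⟩
  have hCx : C *ᵥ x = ((1 + b : ℝ) : ℂ) • h := by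
    rw [hCB, add_mulVec, hx, vecMulVec_mulVec, hbe]
    ext t
    simp; ring
  have hx2 : x = ((1 + b : ℝ) : ℂ) • (C⁻¹ *ᵥ h) := by
    rw [← mulVec_smul, ← hCx, mulVec_mulVec, Matrix.nonsing_inv_mul _ hdC, one_mulVec]
  have hg : (b : ℂ) = ((1 + b : ℝ) : ℂ) * (star h ⬝ᵥ C⁻¹ *ᵥ h) := by
    rw [← hbe, hx2, dotProduct_smul, smul_eq_mul]
  have hg2 := congrArg Complex.re hg
  rw [Complex.re_ofReal_mul, Complex.ofReal_re] at hg2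
  rw [hbe, Complex.ofReal_re]
  have hp : 0 < 1 + b := by linarith
  refine ⟨hp, ?_⟩
  apply eq_inv_of_mul_eq_one_left
  linarith

theorem aux_lower (hσ : 0 < σ2) (U : I → Fin N → ℂ) (w : ℝ) (hw : 0 < w) :
    - rate cell H σ2 V i ≤ w * mse cell H σ2 U V i - Real.log w - 1 := by
  obtain ⟨hp, he⟩ := aux_inv cell H σ2 V i hσ
  have ho := aux_opt cell H σ2 V i hσ U
  have hq := ((aux_posDef_full cell H σ2 V i hσ).posSemidef.dotProduct_mulVec_nonneg
    (U i - (covFull cell H σ2 V i)⁻¹ *ᵥ (H (cell i) i *ᵥ V i)))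
  rw [Complex.le_def] at hq
  have hq1 := hq.1
  rw [Complex.zero_re] at hq1
  rw [he] at ho
  unfold rate
  rw [← Real.log_inv]
  have hpi := inv_pos.2 hp
  set e := mse cell H σ2 U V i
  have hle := le_trans (le_add_of_nonneg_right hq1) ho.ge
  have hepos : 0 < e := lt_of_lt_of_le hpi hle
  have h1 := Real.log_le_log hpi hle
  have h2 := Real.log_le_sub_one_of_pos (mul_pos hw hepos)
  rw [Real.log_mul hw.ne' hepos.ne'] at h2
  linarith

end

/-- Theorem 3 (equivalence of SGqP-WMSE minimization and SLqP rate maximization): for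
every `V`, the infimum over all receive vectors `U` and positive weights `W` of
`F_m((w_{k,b} e_{k,b}(U,V) − log w_{k,b} − 1)_{k,b})` equals `−f_m((r_{k,b}(V))_{k,b})`,
attained at the MMSE receivers `u_{k,b} = (σ²I + ∑ H v v† H†)⁻¹ H v_{k,b}` and the
optimal weights `w_{k,b} = (1 − v† H† (σ²I + ∑ H v v† H†)⁻¹ H v)⁻¹`. -/
theorem sgqp_wmse_equivalence {I B' : Type*} [Fintype I] [DecidableEq I] {N M : ℕ}
    (cell : I → B') (H : B' → I → Matrix (Fin N) (Fin M) ℂ)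
    (σ2 : ℝ) (hσ : 0 < σ2) (m : ℕ) (hm1 : 1 ≤ m) (hm2 : m ≤ Fintype.card I)
    (V : I → Fin M → ℂ) :
    (∀ i, 0 < (1 - (star (H (cell i) i *ᵥ V i) ⬝ᵥ
        (covFull cell H σ2 V i)⁻¹ *ᵥ (H (cell i) i *ᵥ V i)).re)⁻¹) ∧
    sumGreatest m (fun i =>
        (1 - (star (H (cell i) i *ᵥ V i) ⬝ᵥ
          (covFull cell H σ2 V i)⁻¹ *ᵥ (H (cell i) i *ᵥ V i)).re)⁻¹ *
          mse cell H σ2 (fun j => (covFull cell H σ2 V j)⁻¹ *ᵥ (H (cell j) j *ᵥ V j)) V i -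
        Real.log ((1 - (star (H (cell i) i *ᵥ V i) ⬝ᵥ
          (covFull cell H σ2 V i)⁻¹ *ᵥ (H (cell i) i *ᵥ V i)).re)⁻¹) - 1) =
      - sumLeast m (fun i => rate cell H σ2 V i) ∧
    IsLeast {r : ℝ | ∃ (U : I → Fin N → ℂ) (W : I → ℝ), (∀ i, 0 < W i) ∧
        r = sumGreatest m (fun i => W i * mse cell H σ2 U V i - Real.log (W i) - 1)}
      (- sumLeast m (fun i => rate cell H σ2 V i)) := by
  have hpos : ∀ i, 0 < (1 - (star (H (cell i) i *ᵥ V i) ⬝ᵥ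
        (covFull cell H σ2 V i)⁻¹ *ᵥ (H (cell i) i *ᵥ V i)).re)⁻¹ := by
    intro i
    obtain ⟨hp, he⟩ := aux_inv cell H σ2 V i hσ
    rw [he, inv_inv]
    exact hp
  have heq : sumGreatest m (fun i =>
        (1 - (star (H (cell i) i *ᵥ V i) ⬝ᵥ
          (covFull cell H σ2 V i)⁻¹ *ᵥ (H (cell i) i *ᵥ V i)).re)⁻¹ *
          mse cell H σ2 (fun j => (covFull cell H σ2 V j)⁻¹ *ᵥ (H (cell j) j *ᵥ V j)) V i -
        Real.log ((1 - (star (H (cell i) i *ᵥ V i) ⬝ᵥ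
          (covFull cell H σ2 V i)⁻¹ *ᵥ (H (cell i) i *ᵥ V i)).re)⁻¹) - 1) =
      - sumLeast m (fun i => rate cell H σ2 V i) := by
    rw [← aux_sumGreatest_neg]
    congr 1
    funext i
    obtain ⟨hp, he⟩ := aux_inv cell H σ2 V i hσ
    rw [aux_opt cell H σ2 V i hσ, he, inv_inv, sub_self, star_zero, zero_dotProduct,
      Complex.zero_re, add_zero, mul_inv_cancel₀ hp.ne']
    unfold rate
    ring
  refine ⟨hpos, heq, ⟨_, _, hpos, heq.symm⟩, ?_⟩
  rintro r ⟨U, W, hW, rfl⟩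
  rw [← aux_sumGreatest_neg]
  exact aux_sumGreatest_mono m hm2 _ _ (fun i => aux_lower cell H σ2 V i hσ U (W i) (hW i))
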